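/- Let p and q be primes, let F be a free group with basis x_1, y_1, …, x_d, y_d (d ≥ 1) and let w = [x_1,y_1]⋯[x_d,y_d]. Let u ∈ F be measure equivalent to w in every finite group of the pseudovariety N_p(A_f N_q). Then u is not a proper power in F: there is no v ∈ F and integer r ≥ 2 with u = v^r. -/

import Mathlib

open scoped commutatorElement

/-- Two words `w, u` of the free group on `α` are *measure equivalent* in a group `Q` if for
every `g : Q` the fibers of the respective word maps `(α → Q) → Q` over `g` have the same
cardinality. -/
def MeasureEquivIn {α : Type*} (w u : FreeGroup α) (Q : Type*) [Group Q] : Prop :=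
  ∀ g : Q, Nat.card {f : α → Q // FreeGroup.lift f w = g} =
    Nat.card {f : α → Q // FreeGroup.lift f u = g}

/-- Membership in the pseudovariety `𝒩_p(𝒜_f 𝒩_q)`: `Q` has normal subgroups `N ≤ M` with
`N` a `p`-group, `M/N` abelian and `Q/M` a `q`-group. -/
def MemNpAfNq (p q : ℕ) (Q : Type*) [Group Q] : Prop :=
  ∃ N M : Subgroup Q, N.Normal ∧ M.Normal ∧ N ≤ M ∧ IsPGroup p N ∧
    (∀ a ∈ M, ∀ b ∈ M, ⁅a, b⁆ ∈ N) ∧ (∀ x : Q, ∃ n : ℕ, x ^ q ^ n ∈ M)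

/-- The orientable surface relator `[x₁,y₁]⋯[x_d,y_d]`, where `xᵢ = (i, false)` and
`yᵢ = (i, true)`. -/
def orientableRelator (d : ℕ) : FreeGroup (Fin d × Bool) :=
  (List.ofFn fun i : Fin d => ⁅FreeGroup.of (i, false), FreeGroup.of (i, true)⁆).prod

/-- On a finite group, measure equivalent words are identities simultaneously. -/
theorem MeasureEquivIn.lift_eq_one {α Q : Type*} [Finite α] [Group Q] [Finite Q]
    {w u : FreeGroup α} (h : MeasureEquivIn w u Q) (hw : ∀ f : α → Q, FreeGroup.lift f w = 1)
    (f : α → Q) : FreeGroup.lift f u = 1 := by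
  have : Nonempty {f' : α → Q // FreeGroup.lift f' u = FreeGroup.lift f u} := ⟨⟨f, rfl⟩⟩
  have hpos : 0 < Nat.card {f' : α → Q // FreeGroup.lift f' w = FreeGroup.lift f u} := by
    rw [h]
    exact Nat.card_pos
  obtain ⟨⟨f', hf'⟩⟩ := (Nat.card_pos_iff.mp hpos).1
  rw [← hf', hw]

theorem MeasureEquivIn.symm {α Q : Type*} [Group Q] {w u : FreeGroup α}
    (h : MeasureEquivIn w u Q) : MeasureEquivIn u w Q :=
  fun g => (h g).symm

theorem memNpAfNq_of_commGroup (p q : ℕ) (A : Type*) [CommGroup A] : MemNpAfNq p q A :=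
  ⟨⊥, ⊤, inferInstance, inferInstance, bot_le, IsPGroup.of_bot,
    fun a _ b _ => by simp [commutatorElement_eq_one_iff_mul_comm.mpr (mul_comm a b)],
    fun _ => ⟨0, Subgroup.mem_top _⟩⟩

theorem lift_orientableRelator {Q : Type*} [Group Q] (d : ℕ) (f : Fin d × Bool → Q) :
    FreeGroup.lift f (orientableRelator d) =
      (List.ofFn fun i : Fin d => ⁅f (i, false), f (i, true)⁆).prod := by
  simp [orientableRelator, map_list_prod, List.map_ofFn, Function.comp_def, map_commutatorElement]

theorem lift_orientableRelator_eq_one {A : Type*} [CommGroup A] (d : ℕ)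
    (f : Fin d × Bool → A) : FreeGroup.lift f (orientableRelator d) = 1 := by
  rw [lift_orientableRelator]
  refine List.prod_eq_one fun x hx => ?_
  obtain ⟨i, rfl⟩ := List.mem_ofFn.mp hx
  exact commutatorElement_eq_one_iff_mul_comm.mpr (mul_comm _ _)

/-- A group in which the relator of a surface of positive genus is an identity is abelian. -/
theorem mul_comm_of_lift_orientableRelator_eq_one {Q : Type*} [Group Q] {d : ℕ} (hd : 1 ≤ d)
    (h : ∀ f : Fin d × Bool → Q, FreeGroup.lift f (orientableRelator d) = 1) (x y : Q) :
    x * y = y * x := by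
  obtain ⟨k, rfl⟩ := Nat.exists_eq_add_of_le' hd
  have hxy := h fun i => if i.1 = 0 then (if i.2 then y else x) else 1
  rw [lift_orientableRelator, List.ofFn_succ, List.prod_cons,
    List.prod_eq_one (l := List.ofFn _) (by simp [Fin.succ_ne_zero])] at hxy
  exact commutatorElement_eq_one_iff_mul_comm.mp (by simpa using hxy)

namespace RegularWreathProduct

theorem ker_rightHom_mul_comm {D Q : Type*} [CommGroup D] [Group Q] {a b : D ≀ᵣ Q}
    (ha : a.right = 1) (hb : b.right = 1) : a * b = b * a := by
  ext <;> simp [ha, hb, mul_comm]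

theorem pow_left_of_right_eq_one {D Q : Type*} [Group D] [Group Q] {a : D ≀ᵣ Q}
    (ha : a.right = 1) (n : ℕ) : (a ^ n).left = a.left ^ n := by
  induction n with
  | zero => simp
  | succ n ih => rw [pow_succ', mul_left, ih, ha, pow_succ']; simp; rfl

theorem memNpAfNq (p : ℕ) {q : ℕ} {D Q : Type*} [CommGroup D] [Group Q] (hQ : IsPGroup q Q) :
    MemNpAfNq p q (D ≀ᵣ Q) := by
  refine ⟨⊥, rightHom.ker, inferInstance, inferInstance, bot_le, IsPGroup.of_bot,
    fun a ha b hb => ?_, fun x => ?_⟩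
  · rw [Subgroup.mem_bot, commutatorElement_eq_one_iff_mul_comm]
    exact ker_rightHom_mul_comm ha hb
  · obtain ⟨n, hn⟩ := hQ x.right
    exact ⟨n, by rw [MonoidHom.mem_ker, map_pow, rightHom_eq_right, hn]⟩

theorem not_commutative {D Q : Type*} [Group D] [Group Q] [Nontrivial D] [Nontrivial Q] :
    ¬ ∀ x y : D ≀ᵣ Q, x * y = y * x := by
  classical
  intro h
  obtain ⟨g, hg⟩ := exists_ne (1 : D)
  obtain ⟨t, ht⟩ := exists_ne (1 : Q)
  have := congrFun (congrArg left (h ⟨Pi.mulSingle 1 g, 1⟩ ⟨1, t⟩)) 1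
  simp [ht, hg] at this

end RegularWreathProduct

/-- If a proper power `v ^ r` is an identity in `ℤ/rq`, then `v` is an identity in `ℤ/q`. -/
theorem lift_zmod_eq_one_of_lift_pow_eq_one {α : Type*} {q r : ℕ} (hr : r ≠ 0)
    {v : FreeGroup α}
    (h : ∀ f : α → Multiplicative (ZMod (r * q)), FreeGroup.lift f (v ^ r) = 1)
    (f : α → Multiplicative (ZMod q)) : FreeGroup.lift f v = 1 := by
  let g : α → Multiplicative ℤ := fun a => .ofAdd ((f a).toAdd.cast : ℤ)
  let π (n : ℕ) : Multiplicative ℤ →* Multiplicative (ZMod n) :=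
    AddMonoidHom.toMultiplicative (Int.castAddHom (ZMod n))
  have hπ (n : ℕ) (x : FreeGroup α) :
      FreeGroup.lift (π n ∘ g) x = π n (FreeGroup.lift g x) :=
    DFunLike.congr_fun (FreeGroup.ext_hom _ ((π n).comp (FreeGroup.lift g)) (by simp)) x
  have hf : π q ∘ g = f := by
    ext a
    simp [π, g]
  have hπ_one (n : ℕ) (z : Multiplicative ℤ) : π n z = 1 ↔ (n : ℤ) ∣ z.toAdd :=
    ZMod.intCast_zmod_eq_zero_iff_dvd _ _
  have hdvd := h (π (r * q) ∘ g)
  rw [hπ, hπ_one, map_pow, toAdd_pow, Nat.cast_mul, nsmul_eq_mul] at hdvd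
  rw [← hf, hπ, hπ_one]
  exact Int.dvd_of_mul_dvd_mul_left (by exact_mod_cast hr) hdvd

/-- A word measure equivalent to the orientable surface word `w = [x₁,y₁]⋯[x_d,y_d]` in every
finite group of the pseudovariety `𝒩_p(𝒜_f 𝒩_q)` is not a proper power. -/
theorem stmt12 (p q : ℕ) (hp : p.Prime) (hq : q.Prime) (d : ℕ) (hd : 1 ≤ d)
    (u : FreeGroup (Fin d × Bool))
    (h : ∀ (Q : Type) [Group Q] [Finite Q], MemNpAfNq p q Q →
      MeasureEquivIn (orientableRelator d) u Q) :
    ¬ ∃ (v : FreeGroup (Fin d × Bool)) (r : ℕ), 2 ≤ r ∧ u = v ^ r := by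
  rintro ⟨v, r, hr, rfl⟩
  have : Fact q.Prime := ⟨hq⟩
  have : Fact (1 < r) := ⟨hr⟩
  have : NeZero r := ⟨by lia⟩
  have hv := lift_zmod_eq_one_of_lift_pow_eq_one (q := q) (v := v) (NeZero.ne r) <|
    (h _ (memNpAfNq_of_commGroup p q _)).lift_eq_one (lift_orientableRelator_eq_one d)
  have hQ : IsPGroup q (Multiplicative (ZMod q)) := IsPGroup.of_card (n := 1) (by simp)
  let G := Multiplicative (ZMod r) ≀ᵣ Multiplicative (ZMod q)
  refine RegularWreathProduct.not_commutative (mul_comm_of_lift_orientableRelator_eq_one (Q := G) hd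
    ((h G (RegularWreathProduct.memNpAfNq p hQ)).symm.lift_eq_one fun f => ?_))
  have hright : (FreeGroup.lift f v).right = 1 := by
    rw [← hv (RegularWreathProduct.rightHom ∘ f)]
    exact DFunLike.congr_fun (FreeGroup.ext_hom
      (RegularWreathProduct.rightHom.comp (FreeGroup.lift f)) _ (by simp)) v
  rw [map_pow]
  refine RegularWreathProduct.ext ?_ ?_
  · rw [RegularWreathProduct.pow_left_of_right_eq_one hright]
    funext x
    exact ZModModule.char_nsmul_eq_zero r ((FreeGroup.lift f v).left x).toAdd
  · rw [← RegularWreathProduct.rightHom_eq_right, map_pow, RegularWreathProduct.rightHom_eq_right,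
      hright, one_pow, RegularWreathProduct.one_right]
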